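/- Under hypotheses (Hγ), (Hη), (Hη0) and the stated choice of L, the third Craig condition holds: for each exponent α ∈ {1/2, 1}, sup_{m ∈ ℤ^ν ∖ {0}} ∑_{n ≠ m} (γ_m^{1/2} γ_n^{1/2} / η_{m,n})^α (1 + η_{m,0}) C_m < ∞. -/

import Mathlib

open scoped Real BigOperators
open Real

noncomputable section

/-- `|m| = ∑_i |m_i|` (ℓ¹ norm on `ℤ^ν`, as a real number). -/
def znorm {ν : ℕ} (m : Fin ν → ℤ) : ℝ := ∑ i, |(m i : ℝ)|

/-- Distance between the gaps labelled `m` and `n`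
(equals `dist ([Em m, Ep m], [Em n, Ep n])` when these closed intervals are disjoint). -/
def gapDist {ν : ℕ} (Em Ep : (Fin ν → ℤ) → ℝ) (m n : Fin ν → ℤ) : ℝ :=
  max (Em n - Ep m) (Em m - Ep n)

/-- Gap length `γ_m = E_m^+ - E_m^-`. -/
def gapLen {ν : ℕ} (Em Ep : (Fin ν → ℤ) → ℝ) (m : Fin ν → ℤ) : ℝ := Ep m - Em m

/-- The exceptional set `R_m = { n ∈ ℤ^ν ∖ {0} : n ≠ m, γ_n > L η_{n,m}⁴ }`. -/
def Rset {ν : ℕ} (Em Ep : (Fin ν → ℤ) → ℝ) (L : ℝ) (m : Fin ν → ℤ) : Set (Fin ν → ℤ) :=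
  {n | n ≠ 0 ∧ n ≠ m ∧ L * gapDist Em Ep n m ^ 4 < gapLen Em Ep n}

/-- `C_m = (η_{m,0} + γ_m)^{1/2} ∏_{n ≠ m} (1 + γ_n/η_{m,n})^{1/2}`, the product running over
all nonzero labels `n ≠ m`. -/
def Cm {ν : ℕ} (Em Ep : (Fin ν → ℤ) → ℝ) (E0 : ℝ) (m : Fin ν → ℤ) : ℝ :=
  Real.sqrt ((Em m - E0) + gapLen Em Ep m) *
    ∏' n : {n : Fin ν → ℤ // n ≠ 0 ∧ n ≠ m},
      Real.sqrt (1 + gapLen Em Ep n / gapDist Em Ep m n)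

theorem aux_polyexp (p δ : ℝ) (hp : 0 < p) (hδ : 0 < δ) :
    ∃ K : ℝ, 0 < K ∧ ∀ t : ℝ, 0 ≤ t → t ^ p ≤ K * Real.exp (δ * t) := by
  have hd : 0 < δ / p := by positivity
  refine ⟨(1 / (δ / p)) ^ p, by positivity, fun t ht => ?_⟩
  have h1 : t ≤ 1 / (δ / p) * Real.exp (δ / p * t) := by
    have := Real.add_one_le_exp (δ / p * t)
    rw [one_div, ← div_eq_inv_mul, le_div_iff₀ hd]
    linarith
  calc t ^ p ≤ (1 / (δ / p) * Real.exp (δ / p * t)) ^ p := Real.rpow_le_rpow ht h1 hp.le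
    _ = _ := by
      rw [Real.mul_rpow (by positivity) (Real.exp_pos _).le, ← Real.exp_mul]
      congr 2
      field_simp

theorem aux_sum_exp_int (δ : ℝ) (hδ : 0 < δ) :
    Summable fun k : ℤ => Real.exp (-(δ * |(k : ℝ)|)) := by
  have h : Summable fun k : ℕ => Real.exp (-(δ * (k : ℝ))) := by
    have := Real.summable_exp_nat_mul_of_ge (c := -δ) (by linarith) (f := fun i => (i : ℝ))
      (fun i => le_rfl)
    simpa using this
  apply Summable.of_nat_of_neg
  · simpa using h
  · simpa using h

theorem znorm_nonneg {ν : ℕ} (m : Fin ν → ℤ) : 0 ≤ znorm m :=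
  Finset.sum_nonneg fun i _ => abs_nonneg _

theorem one_le_znorm {ν : ℕ} (m : Fin ν → ℤ) (hm : m ≠ 0) : 1 ≤ znorm m := by
  obtain ⟨i, hi⟩ := Function.ne_iff.mp hm
  have h1 : (1 : ℝ) ≤ |(m i : ℝ)| := by exact_mod_cast Int.one_le_abs hi
  exact h1.trans (Finset.single_le_sum (f := fun i => |(m i : ℝ)|)
    (fun i _ => abs_nonneg _) (Finset.mem_univ i))

theorem aux_sum_exp {ν : ℕ} (δ : ℝ) (hδ : 0 < δ) :
    Summable fun n : Fin ν → ℤ => Real.exp (-(δ * znorm n)) := by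
  classical
  have h := aux_sum_exp_int δ hδ
  apply summable_of_sum_le (c := (∑' k : ℤ, Real.exp (-(δ * |(k : ℝ)|))) ^ ν)
  · intro n; exact (Real.exp_pos _).le
  · intro u
    have hsub : u ⊆ Fintype.piFinset (fun i : Fin ν => u.image (fun f => f i)) := by
      intro f hf
      rw [Fintype.mem_piFinset]
      intro i
      exact Finset.mem_image_of_mem (fun f : Fin ν → ℤ => f i) hf
    have he : ∀ n : Fin ν → ℤ, Real.exp (-(δ * znorm n))
        = ∏ i, Real.exp (-(δ * |((n i : ℤ) : ℝ)|)) := by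
      intro n
      rw [← Real.exp_sum, znorm, Finset.mul_sum, Finset.sum_neg_distrib]
    calc ∑ n ∈ u, Real.exp (-(δ * znorm n))
        ≤ ∑ n ∈ Fintype.piFinset (fun i : Fin ν => u.image (fun f => f i)),
            Real.exp (-(δ * znorm n)) :=
          Finset.sum_le_sum_of_subset_of_nonneg hsub fun _ _ _ => (Real.exp_pos _).le
      _ = ∏ i : Fin ν, ∑ k ∈ u.image (fun f : Fin ν → ℤ => (f i : ℤ)), Real.exp (-(δ * |(k : ℝ)|)) := by
          rw [Finset.prod_univ_sum]
          exact Finset.sum_congr rfl fun n _ => he n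
      _ ≤ ∏ i : Fin ν, ∑' k : ℤ, Real.exp (-(δ * |(k : ℝ)|)) := by
          apply Finset.prod_le_prod
          · intro i _; exact Finset.sum_nonneg fun _ _ => (Real.exp_pos _).le
          · intro i _; exact h.sum_le_tsum _ fun _ _ => (Real.exp_pos _).le
      _ = _ := by simp

theorem aux_sum_polyexp {ν : ℕ} (p δ : ℝ) (hp : 0 < p) (hδ : 0 < δ) :
    Summable fun n : Fin ν → ℤ => znorm n ^ p * Real.exp (-(δ * znorm n)) := by
  obtain ⟨K, hK, h⟩ := aux_polyexp p (δ / 2) hp (by positivity)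
  refine Summable.of_nonneg_of_le (fun n => mul_nonneg (Real.rpow_nonneg (znorm_nonneg n) _)
    (Real.exp_pos _).le) (fun n => ?_) ((aux_sum_exp (ν := ν) (δ / 2) (by positivity)).mul_left K)
  calc znorm n ^ p * Real.exp (-(δ * znorm n))
      ≤ K * Real.exp (δ / 2 * znorm n) * Real.exp (-(δ * znorm n)) := by
        gcongr; exact h _ (znorm_nonneg n)
    _ = _ := by rw [mul_assoc, ← Real.exp_add]; ring_nf

theorem aux_one_add_le (s x : ℝ) (hs : 0 < s) (hs1 : s ≤ 1) (hx : 0 ≤ x) :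
    1 + x ≤ Real.exp (x ^ s / s) := by
  have h1 : (1 + x) ^ s ≤ Real.exp (x ^ s) := by
    have := Real.rpow_add_le_add_rpow (p := s) zero_le_one hx hs.le hs1
    rw [Real.one_rpow] at this
    linarith [Real.add_one_le_exp (x ^ s)]
  have h2 := Real.rpow_le_rpow (by positivity) h1 (inv_pos.mpr hs).le
  rwa [← Real.rpow_mul (by linarith), mul_inv_cancel₀ hs.ne', Real.rpow_one, ← Real.exp_mul,
    ← div_eq_mul_inv] at h2

theorem aux_tprod {ι : Type*} (f g : ι → ℝ) (hf : ∀ i, 0 ≤ f i) (hfg : ∀ i, f i ≤ Real.exp (g i))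
    (S : ℝ) (hS0 : 0 ≤ S) (hS : ∀ u : Finset ι, ∑ i ∈ u, g i ≤ S) :
    0 ≤ ∏' i, f i ∧ ∏' i, f i ≤ Real.exp S := by
  by_cases h : Multipliable f
  · have hp : Filter.Tendsto (fun u : Finset ι => ∏ i ∈ u, f i) Filter.atTop
      (nhds (∏' i, f i)) := h.hasProd
    refine ⟨ge_of_tendsto' hp fun u => Finset.prod_nonneg fun i _ => hf i,
      le_of_tendsto' hp fun u => ?_⟩
    calc ∏ i ∈ u, f i ≤ ∏ i ∈ u, Real.exp (g i) := Finset.prod_le_prod (fun i _ => hf i)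
          fun i _ => hfg i
      _ = Real.exp (∑ i ∈ u, g i) := (Real.exp_sum _ _).symm
      _ ≤ _ := Real.exp_le_exp.mpr (hS u)
  · rw [tprod_eq_one_of_not_multipliable h]
    exact ⟨zero_le_one, Real.one_le_exp hS0⟩

/-- Elementary final bound. -/
theorem aux_final (p δ C : ℝ) (hp : 0 < p) (hδ : 0 < δ) :
    ∃ K : ℝ, 0 < K ∧ ∀ t : ℝ, 1 ≤ t →
      t ^ p * Real.exp (-(δ * t)) * Real.exp (C * Real.sqrt t) ≤ K := by
  obtain ⟨K, hK, h⟩ := aux_polyexp p (δ / 2) hp (by positivity)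
  refine ⟨K * Real.exp (C ^ 2 / (2 * δ)), by positivity, fun t ht => ?_⟩
  have hsq : Real.sqrt t ^ 2 = t := Real.sq_sqrt (by linarith)
  have h2 : C * Real.sqrt t ≤ C ^ 2 / (2 * δ) + δ / 2 * t := by
    have : C ^ 2 / (2 * δ) + δ / 2 * t - C * Real.sqrt t
        = (C - δ * Real.sqrt t) ^ 2 / (2 * δ) := by
      field_simp
      ring_nf
      rw [hsq]
    have h3 : 0 ≤ (C - δ * Real.sqrt t) ^ 2 / (2 * δ) := by positivity
    linarith
  calc t ^ p * Real.exp (-(δ * t)) * Real.exp (C * Real.sqrt t)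
      ≤ (K * Real.exp (δ / 2 * t)) * Real.exp (-(δ * t)) *
          Real.exp (C ^ 2 / (2 * δ) + δ / 2 * t) := by
        gcongr
        exact h t (by linarith)
    _ = K * Real.exp (C ^ 2 / (2 * δ)) := by
        rw [mul_assoc, mul_assoc, ← Real.exp_add, ← Real.exp_add]
        ring_nf

theorem aux_sum_sub {ι : Type*} (P : ι → Prop) (g : ι → ℝ) (hg : ∀ i, 0 ≤ g i) (h : Summable g)
    (u : Finset {i // P i}) : ∑ i ∈ u, g i ≤ ∑' i, g i := by
  have := h.sum_le_tsum (u.map (Function.Embedding.subtype P)) fun i _ => hg i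
  simpa using this

/-- The third Craig condition: for each exponent `α ∈ {1/2, 1}`,
`sup_{m≠0} ∑_{n≠m} (γ_m^{1/2} γ_n^{1/2}/η_{m,n})^α (1 + η_{m,0}) C_m < ∞`
(in particular each inner series is summable). -/
theorem third_craig_condition
    {ν : ℕ} (hν : 0 < ν) (ε κ₀ a b c E0 L : ℝ)
    (hε : 0 < ε) (hκ₀ : 0 < κ₀) (hκ₁ : κ₀ ≤ 1) (ha : 0 < a) (hb : 0 < b) (hc : 0 < c)
    (Em Ep : (Fin ν → ℤ) → ℝ)
    (hlt : ∀ m : Fin ν → ℤ, m ≠ 0 → Em m < Ep m)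
    (hE0 : ∀ m : Fin ν → ℤ, m ≠ 0 → E0 < Em m)
    (hdisj : ∀ m n : Fin ν → ℤ, m ≠ 0 → n ≠ 0 → m ≠ n → Ep m < Em n ∨ Ep n < Em m)
    (Hγ : ∀ m : Fin ν → ℤ, m ≠ 0 →
      gapLen Em Ep m < 2 * ε * Real.exp (-(κ₀ * znorm m) / 2))
    (Hη : ∀ m n : Fin ν → ℤ, m ≠ 0 → n ≠ 0 → m ≠ n → znorm n ≤ znorm m →
      a * znorm m ^ (-b) ≤ gapDist Em Ep m n)
    (Hη0low : ∀ m : Fin ν → ℤ, m ≠ 0 → a * znorm m ^ (-b) ≤ Em m - E0)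
    (Hη0 : ∀ m : Fin ν → ℤ, m ≠ 0 → Em m - E0 ≤ c * znorm m ^ (2 : ℕ))
    (hL : 0 < L)
    (hLbig : ∀ m : Fin ν → ℤ, m ≠ 0 →
      2 * ε * Real.exp (-(κ₀ * znorm m) / 2) < L * a ^ 4 * znorm m ^ (-(4 * b)))
    :
    ∀ α : ℝ, α = 1 / 2 ∨ α = 1 →
      (∀ m : Fin ν → ℤ, m ≠ 0 →
        Summable fun n : {n : Fin ν → ℤ // n ≠ 0 ∧ n ≠ m} =>
          (Real.sqrt (gapLen Em Ep m) * Real.sqrt (gapLen Em Ep n) / gapDist Em Ep m n) ^ α *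
            (1 + (Em m - E0)) * Cm Em Ep E0 m) ∧
      (∃ M : ℝ, ∀ m : Fin ν → ℤ, m ≠ 0 →
        (∑' n : {n : Fin ν → ℤ // n ≠ 0 ∧ n ≠ m},
          (Real.sqrt (gapLen Em Ep m) * Real.sqrt (gapLen Em Ep n) / gapDist Em Ep m n) ^ α *
            (1 + (Em m - E0)) * Cm Em Ep E0 m) ≤ M) := by
  have hγ0 : ∀ m : Fin ν → ℤ, m ≠ 0 → 0 < gapLen Em Ep m := fun m hm => sub_pos.mpr (hlt m hm)
  have hη : ∀ m n : Fin ν → ℤ, m ≠ 0 → n ≠ 0 → m ≠ n →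
      0 < gapDist Em Ep m n ∧ 1 / gapDist Em Ep m n ≤ znorm m ^ b * znorm n ^ b / a := by
    intro m n hm hn hmn
    have h1m := one_le_znorm m hm
    have h1n := one_le_znorm n hn
    have hpm : 0 < znorm m ^ b := Real.rpow_pos_of_pos (by linarith) _
    have hpn : 0 < znorm n ^ b := Real.rpow_pos_of_pos (by linarith) _
    have h1pm : 1 ≤ znorm m ^ b := Real.one_le_rpow h1m hb.le
    have h1pn : 1 ≤ znorm n ^ b := Real.one_le_rpow h1n hb.le
    have key : a / (znorm m ^ b * znorm n ^ b) ≤ gapDist Em Ep m n := by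
      rcases le_total (znorm n) (znorm m) with h | h
      · refine le_trans ?_ (Hη m n hm hn hmn h)
        rw [Real.rpow_neg (by linarith), ← div_eq_mul_inv]
        gcongr
        nlinarith
      · have hs : gapDist Em Ep m n = gapDist Em Ep n m := max_comm _ _
        rw [hs]
        refine le_trans ?_ (Hη n m hn hm hmn.symm h)
        rw [Real.rpow_neg (by linarith), ← div_eq_mul_inv]
        gcongr
        nlinarith
    have hpos : 0 < a / (znorm m ^ b * znorm n ^ b) := by positivity
    refine ⟨hpos.trans_le key, ?_⟩
    calc 1 / gapDist Em Ep m n ≤ 1 / (a / (znorm m ^ b * znorm n ^ b)) :=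
          one_div_le_one_div_of_le hpos key
      _ = _ := by rw [one_div_div]
  -- bound on the constants `C_m`
  obtain ⟨S, hS0, hC⟩ : ∃ S : ℝ, 0 ≤ S ∧ ∀ m : Fin ν → ℤ, m ≠ 0 → 0 ≤ Cm Em Ep E0 m ∧
      Cm Em Ep E0 m ≤ (Real.sqrt (c + 2 * ε) * znorm m) * Real.exp (S * Real.sqrt (znorm m)) := by
    set s : ℝ := 1 / (2 * b + 1) with hs
    have hs0 : 0 < s := by positivity
    have hs1 : s ≤ 1 := by
      rw [hs, div_le_one (by positivity)]; linarith
    have hbs : b * s ≤ 1 / 2 := by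
      rw [hs, mul_one_div, div_le_div_iff₀ (by positivity) (by positivity)]; linarith
    have hsum := aux_sum_polyexp (ν := ν) (b * s) (κ₀ / 2 * s) (by positivity) (by positivity)
    set g : (Fin ν → ℤ) → ℝ := fun n => znorm n ^ (b * s) * Real.exp (-(κ₀ / 2 * s * znorm n))
      with hg
    have hg0 : ∀ n, 0 ≤ g n := fun n => mul_nonneg (Real.rpow_nonneg (znorm_nonneg n) _)
      (Real.exp_pos _).le
    have hT : 0 ≤ ∑' n, g n := tsum_nonneg hg0
    set A : ℝ := (2 * ε / a) ^ s / s with hA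
    have hA0 : 0 ≤ A := by positivity
    refine ⟨A * ∑' n, g n, by positivity, fun m hm => ?_⟩
    have h1m := one_le_znorm m hm
    have hm0 : 0 ≤ znorm m := znorm_nonneg m
    have hx : ∀ n : {n : Fin ν → ℤ // n ≠ 0 ∧ n ≠ m},
        0 ≤ gapLen Em Ep n / gapDist Em Ep m n := fun n =>
      div_nonneg (hγ0 _ n.2.1).le (hη m n hm n.2.1 n.2.2.symm).1.le
    have hprod := aux_tprod (ι := {n : Fin ν → ℤ // n ≠ 0 ∧ n ≠ m})
      (fun n => Real.sqrt (1 + gapLen Em Ep n / gapDist Em Ep m n))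
      (fun n => A * Real.sqrt (znorm m) * g n) (fun n => Real.sqrt_nonneg _)
      (fun n => by
        have hn0 : 0 ≤ znorm n.1 := znorm_nonneg n.1
        obtain ⟨h1, h2⟩ := hη m n hm n.2.1 n.2.2.symm
        have h3 : gapLen Em Ep n / gapDist Em Ep m n ≤
            (2 * ε / a) * (znorm m ^ b * (znorm n.1 ^ b * Real.exp (-(κ₀ * znorm n.1) / 2))) := by
          rw [div_eq_mul_one_div]
          calc gapLen Em Ep n * (1 / gapDist Em Ep m n)
              ≤ (2 * ε * Real.exp (-(κ₀ * znorm n.1) / 2)) *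
                (znorm m ^ b * znorm n.1 ^ b / a) :=
                mul_le_mul (Hγ _ n.2.1).le h2 (by positivity) (by positivity)
            _ = _ := by ring
        have h4 := Real.rpow_le_rpow (hx n) h3 hs0.le
        rw [Real.mul_rpow (by positivity) (by positivity),
          Real.mul_rpow (by positivity) (by positivity),
          Real.mul_rpow (by positivity) (by positivity), ← Real.rpow_mul hm0,
          ← Real.rpow_mul hn0, ← Real.exp_mul] at h4
        have h5 : -(κ₀ * znorm n.1) / 2 * s = -(κ₀ / 2 * s * znorm n.1) := by ring
        rw [h5] at h4
        have h6 : znorm m ^ (b * s) ≤ Real.sqrt (znorm m) := by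
          rw [Real.sqrt_eq_rpow]
          exact Real.rpow_le_rpow_of_exponent_le h1m hbs
        have h7 : (gapLen Em Ep n / gapDist Em Ep m n) ^ s ≤
            (2 * ε / a) ^ s * (Real.sqrt (znorm m) * g n) :=
          h4.trans (by
            have := hg0 n
            gcongr)
        calc Real.sqrt (1 + gapLen Em Ep n / gapDist Em Ep m n)
            ≤ 1 + gapLen Em Ep n / gapDist Em Ep m n := by
              have := hx n
              exact Real.sqrt_le_iff.mpr ⟨by linarith, by nlinarith⟩
          _ ≤ Real.exp ((gapLen Em Ep n / gapDist Em Ep m n) ^ s / s) :=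
              aux_one_add_le s _ hs0 hs1 (hx n)
          _ ≤ Real.exp (A * Real.sqrt (znorm m) * g n) := by
              apply Real.exp_le_exp.mpr
              calc _ ≤ (2 * ε / a) ^ s * (Real.sqrt (znorm m) * g n) / s := by gcongr
                _ = _ := by rw [hA]; ring)
      (A * (∑' n, g n) * Real.sqrt (znorm m)) (by positivity)
      (fun u => by
        rw [← Finset.mul_sum]
        calc _ ≤ A * Real.sqrt (znorm m) * ∑' n, g n := by
              gcongr
              exact aux_sum_sub _ g hg0 hsum u
          _ = _ := by ring)
    have hsq : Real.sqrt ((Em m - E0) + gapLen Em Ep m) ≤ Real.sqrt (c + 2 * ε) * znorm m := by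
      apply Real.sqrt_le_iff.mpr
      refine ⟨by positivity, ?_⟩
      rw [mul_pow, Real.sq_sqrt (by positivity)]
      have e1 := Hη0 m hm
      have e2 := Hγ m hm
      have e3 : Real.exp (-(κ₀ * znorm m) / 2) ≤ 1 := by
        rw [Real.exp_le_one_iff]
        have : 0 ≤ κ₀ * znorm m := by positivity
        linarith
      have e4 : 2 * ε * Real.exp (-(κ₀ * znorm m) / 2) ≤ 2 * ε * 1 := by gcongr
      have e5 : 1 ≤ znorm m ^ 2 := by nlinarith
      have e6 : 2 * ε * 1 ≤ 2 * ε * znorm m ^ 2 := by gcongr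
      linarith
    unfold Cm
    exact ⟨mul_nonneg (Real.sqrt_nonneg _) hprod.1,
      mul_le_mul hsq hprod.2 hprod.1 (by positivity)⟩
  intro α hα
  have hα0 : 0 < α := by rcases hα with h | h <;> rw [h] <;> norm_num
  have hsum := aux_sum_polyexp (ν := ν) (b * α) (κ₀ / 4 * α) (by positivity) (by positivity)
  set g : (Fin ν → ℤ) → ℝ := fun n => znorm n ^ (b * α) * Real.exp (-(κ₀ / 4 * α * znorm n))
    with hg
  have hg0 : ∀ n, 0 ≤ g n := fun n => mul_nonneg (Real.rpow_nonneg (znorm_nonneg n) _)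
    (Real.exp_pos _).le
  have hT : 0 ≤ ∑' n, g n := tsum_nonneg hg0
  have hterm : ∀ m : Fin ν → ℤ, m ≠ 0 → ∀ n : {n : Fin ν → ℤ // n ≠ 0 ∧ n ≠ m},
      0 ≤ (Real.sqrt (gapLen Em Ep m) * Real.sqrt (gapLen Em Ep n) / gapDist Em Ep m n) ^ α ∧
      (Real.sqrt (gapLen Em Ep m) * Real.sqrt (gapLen Em Ep n) / gapDist Em Ep m n) ^ α ≤
        (2 * ε / a) ^ α * g m * g n := by
    intro m hm n
    have hm0 : 0 ≤ znorm m := znorm_nonneg m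
    have hn0 : 0 ≤ znorm n.1 := znorm_nonneg n.1
    obtain ⟨h1, h2⟩ := hη m n hm n.2.1 n.2.2.symm
    refine ⟨by positivity, ?_⟩
    have hsq : ∀ k : Fin ν → ℤ, k ≠ 0 → Real.sqrt (gapLen Em Ep k) ≤
        Real.sqrt (2 * ε) * Real.exp (-(κ₀ / 4 * znorm k)) := by
      intro k hk
      apply Real.sqrt_le_iff.mpr
      refine ⟨by positivity, ?_⟩
      rw [mul_pow, Real.sq_sqrt (by positivity), ← Real.exp_nat_mul]
      have e0 : ((2 : ℕ) : ℝ) * -(κ₀ / 4 * znorm k) = -(κ₀ * znorm k) / 2 := by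
        push_cast; ring
      rw [e0]
      exact (Hγ k hk).le
    have h3 : Real.sqrt (gapLen Em Ep m) * Real.sqrt (gapLen Em Ep n) / gapDist Em Ep m n ≤
        (2 * ε / a) * ((znorm m ^ b * Real.exp (-(κ₀ / 4 * znorm m))) *
          (znorm n.1 ^ b * Real.exp (-(κ₀ / 4 * znorm n.1)))) := by
      rw [div_eq_mul_one_div]
      calc _ ≤ ((Real.sqrt (2 * ε) * Real.exp (-(κ₀ / 4 * znorm m))) *
            (Real.sqrt (2 * ε) * Real.exp (-(κ₀ / 4 * znorm n.1)))) *
            (znorm m ^ b * znorm n.1 ^ b / a) :=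
            mul_le_mul (mul_le_mul (hsq m hm) (hsq n n.2.1) (Real.sqrt_nonneg _) (by positivity))
              h2 (by positivity) (by positivity)
        _ = (Real.sqrt (2 * ε) * Real.sqrt (2 * ε)) / a *
            ((znorm m ^ b * Real.exp (-(κ₀ / 4 * znorm m))) *
            (znorm n.1 ^ b * Real.exp (-(κ₀ / 4 * znorm n.1)))) := by ring
        _ = _ := by rw [Real.mul_self_sqrt (by positivity)]
    have h4 := Real.rpow_le_rpow (by positivity) h3 hα0.le
    rw [Real.mul_rpow (by positivity) (by positivity),
      Real.mul_rpow (by positivity) (by positivity),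
      Real.mul_rpow (by positivity) (by positivity),
      Real.mul_rpow (by positivity) (by positivity), ← Real.rpow_mul hm0,
      ← Real.rpow_mul hn0, ← Real.exp_mul, ← Real.exp_mul] at h4
    refine h4.trans (le_of_eq ?_)
    have e1 : ∀ t : ℝ, -(κ₀ / 4 * t) * α = -(κ₀ / 4 * α * t) := fun t => by ring
    rw [e1, e1]
    simp only [hg]
    ring
  have hsub : ∀ m : Fin ν → ℤ, Summable fun n : {n : Fin ν → ℤ // n ≠ 0 ∧ n ≠ m} => g n :=
    fun m => hsum.comp_injective Subtype.val_injective
  have hsumm : ∀ m : Fin ν → ℤ, m ≠ 0 →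
      Summable fun n : {n : Fin ν → ℤ // n ≠ 0 ∧ n ≠ m} =>
        (Real.sqrt (gapLen Em Ep m) * Real.sqrt (gapLen Em Ep n) / gapDist Em Ep m n) ^ α :=
    fun m hm => Summable.of_nonneg_of_le (fun n => (hterm m hm n).1) (fun n => (hterm m hm n).2)
      ((hsub m).mul_left _)
  refine ⟨fun m hm => ((hsumm m hm).mul_right _).mul_right _, ?_⟩
  obtain ⟨K, hK, hfin⟩ := aux_final (b * α + 3) (κ₀ / 4 * α) S (by positivity) (by positivity)
  refine ⟨(2 * ε / a) ^ α * (∑' n, g n) * (1 + c) * Real.sqrt (c + 2 * ε) * K, fun m hm => ?_⟩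
  have h1m := one_le_znorm m hm
  have hm0 : 0 ≤ znorm m := znorm_nonneg m
  rw [tsum_mul_right, tsum_mul_right]
  have hE : 0 < Em m - E0 := sub_pos.mpr (hE0 m hm)
  have b1 : (∑' n : {n : Fin ν → ℤ // n ≠ 0 ∧ n ≠ m},
      (Real.sqrt (gapLen Em Ep m) * Real.sqrt (gapLen Em Ep n) / gapDist Em Ep m n) ^ α) ≤
      (2 * ε / a) ^ α * g m * ∑' n, g n := by
    apply (hsumm m hm).tsum_le_of_sum_le
    intro u
    have := hg0 m
    calc _ ≤ ∑ n ∈ u, (2 * ε / a) ^ α * g m * g n :=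
          Finset.sum_le_sum fun n _ => (hterm m hm n).2
      _ = (2 * ε / a) ^ α * g m * ∑ n ∈ u, g n := (Finset.mul_sum _ _ _).symm
      _ ≤ _ := by
          gcongr
          exact aux_sum_sub _ g hg0 hsum u
  have b2 : 1 + (Em m - E0) ≤ (1 + c) * znorm m ^ 2 := by
    have := Hη0 m hm
    nlinarith
  obtain ⟨c0, c1⟩ := hC m hm
  have hgm := hg0 m
  calc _ ≤ ((2 * ε / a) ^ α * g m * ∑' n, g n) * ((1 + c) * znorm m ^ 2) *
        ((Real.sqrt (c + 2 * ε) * znorm m) * Real.exp (S * Real.sqrt (znorm m))) :=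
        mul_le_mul (mul_le_mul b1 b2 (by linarith) (by positivity)) c1 c0 (by positivity)
    _ = (2 * ε / a) ^ α * (∑' n, g n) * (1 + c) * Real.sqrt (c + 2 * ε) *
        (znorm m ^ (b * α + 3) * Real.exp (-(κ₀ / 4 * α * znorm m)) *
          Real.exp (S * Real.sqrt (znorm m))) := by
        rw [Real.rpow_add (by linarith)]
        have : znorm m ^ (3 : ℝ) = znorm m ^ (3 : ℕ) := by
          exact_mod_cast Real.rpow_natCast (znorm m) 3
        rw [this]
        simp only [hg]
        ring
    _ ≤ _ := by
        gcongr
        exact hfin _ h1m
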